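/- arXiv:1001.0771 — 4 statements merged into one kernel-verified Lean document; each statement's English description precedes it below -/
import Mathlib

section
/- Let G be a finite group and let H be a subgroup of G whose order is divisible by a prime p, such that H is a p-group and H is nontrivial. Then there exists an integer k > 0 such that φ^H(I(G)), the ideal of ℤ generated by the integers |(G/K)^H| − |G:K| as K ranges over all subgroups of G, is equal to the ideal of ℤ generated by p^k. -/
/-- The ideal `φ^H(I(G))` of `ℤ`: the image of the augmentation ideal of the
Burnside ring under the `H`-fixed-point homomorphism.  It is generated by the
integers `|(G/K)^H| - |G:K|` as `K` ranges over all subgroups of `G`, where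
`H` acts on the coset space `G ⧸ K` by left multiplication. -/
def phiIdeal (G : Type*) [Group G] (H : Subgroup G) : Ideal ℤ :=
  Ideal.span {z : ℤ | ∃ K : Subgroup G,
    z = (Nat.card (MulAction.fixedPoints H (G ⧸ K)) : ℤ) - (K.index : ℤ)}

/-- A nontrivial subgroup `H` has no fixed points on `G ⧸ K` when `|H|` and `|K|` are coprime. -/
theorem fixedPoints_quotient_eq_empty_of_coprime {G : Type*} [Group G] {H K : Subgroup G}
    (hne : H ≠ ⊥) (hcop : (Nat.card H).Coprime (Nat.card K)) :
    MulAction.fixedPoints H (G ⧸ K) = ∅ := by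
  refine Set.eq_empty_of_forall_notMem fun x hx => hne ?_
  obtain ⟨g, rfl⟩ := QuotientGroup.mk_surjective x
  refine (Subgroup.eq_bot_iff_forall H).2 fun h hh => ?_
  have hfix : ((h * g : G) : G ⧸ K) = (g : G ⧸ K) := hx ⟨h, hh⟩
  have hmem : g⁻¹ * h * g ∈ K := by
    simpa [mul_assoc] using QuotientGroup.eq.1 hfix.symm
  have horder : orderOf (g⁻¹ * h * g) = orderOf h := by
    simpa using orderOf_injective (MulAut.conj g⁻¹).toMonoidHom (MulAut.conj g⁻¹).injective h
  exact orderOf_eq_one_iff.1 (Nat.eq_one_of_dvd_coprimes hcop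
    (Subgroup.orderOf_dvd_natCard H hh) (horder ▸ Subgroup.orderOf_dvd_natCard K hmem))

theorem index_mem_phiIdeal_of_coprime {G : Type*} [Group G] {H K : Subgroup G}
    (hne : H ≠ ⊥) (hcop : (Nat.card H).Coprime (Nat.card K)) :
    (K.index : ℤ) ∈ phiIdeal G H := by
  rw [← neg_mem_iff]
  refine Ideal.subset_span ⟨K, ?_⟩
  simp [fixedPoints_quotient_eq_empty_of_coprime hne hcop]

theorem phiIdeal_le_span_of_isPGroup {G : Type*} [Group G] [Finite G] {H : Subgroup G} {p : ℕ}
    (hp : p.Prime) (hpgroup : IsPGroup p H) : phiIdeal G H ≤ Ideal.span {(p : ℤ)} := by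
  have := Fact.mk hp
  refine Ideal.span_le.2 ?_
  rintro _ ⟨K, rfl⟩
  exact Ideal.mem_span_singleton.2
    (Nat.modEq_iff_dvd.1 (hpgroup.card_modEq_card_fixedPoints (G ⧸ K)))

theorem stmt0 (G : Type*) [Group G] [Finite G] (H : Subgroup G) (p : ℕ)
    (hp : p.Prime) (hdvd : p ∣ Nat.card H) (hpgroup : IsPGroup p H)
    (hne : H ≠ ⊥) :
    ∃ k : ℕ, 0 < k ∧ phiIdeal G H = Ideal.span {((p : ℤ) ^ k)} := by
  have := Fact.mk hp
  obtain ⟨n, hn⟩ : ∃ n : ℕ, phiIdeal G H = Ideal.span {(n : ℤ)} := by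
    obtain ⟨z, hz⟩ := (IsPrincipalIdealRing.principal (phiIdeal G H)).principal
    exact ⟨z.natAbs, hz.trans (Int.span_natAbs z).symm⟩
  have hindex (K : Subgroup G) (hK : (Nat.card H).Coprime (Nat.card K)) : n ∣ K.index := by
    have h := index_mem_phiIdeal_of_coprime hne hK
    rwa [hn, Ideal.mem_span_singleton, Int.natCast_dvd_natCast] at h
  have hn0 : n ≠ 0 := by
    rintro rfl
    exact Subgroup.index_ne_zero_of_finite (Nat.eq_zero_of_zero_dvd (hindex ⊥ (by simp)))
  have hpn : p ∣ n := by
    have h := phiIdeal_le_span_of_isPGroup hp hpgroup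
    rwa [hn, Ideal.span_singleton_le_span_singleton, Int.natCast_dvd_natCast] at h
  have hunique : ∀ {q : ℕ}, q.Prime → q ∣ n → q = p := by
    intro q hq hqn
    by_contra hqp
    have := Fact.mk hq
    obtain ⟨Q⟩ : Nonempty (Sylow q G) := inferInstance
    obtain ⟨a, ha⟩ := hpgroup.exists_card_eq
    obtain ⟨b, hb⟩ := Q.isPGroup'.exists_card_eq
    refine Q.not_dvd_index (hqn.trans (hindex Q ?_))
    rw [ha, hb]
    exact Nat.Coprime.pow a b ((Nat.coprime_primes hp hq).2 (Ne.symm hqp))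
  have hpow := Nat.eq_prime_pow_of_unique_prime_dvd hn0 hunique
  refine ⟨n.primeFactorsList.length, Nat.pos_of_ne_zero fun h0 => ?_, ?_⟩
  · rw [h0, pow_zero] at hpow
    exact hp.one_lt.ne' (Nat.dvd_one.1 (hpow ▸ hpn))
  · rw [hn]
    exact congrArg (fun m : ℤ => Ideal.span {m}) (by exact_mod_cast hpow)
end

section
/- Let G be a finite group and let H be a subgroup of G whose order is divisible by two distinct primes. Then φ^H(I(G)), the ideal of ℤ generated by the integers |(G/K)^H| − |G:K| as K ranges over all subgroups of G, is all of ℤ. -/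
/-- A subgroup whose order has a prime factor other than `l` fixes no coset of an `l`-subgroup. -/
theorem isEmpty_fixedPoints_quotient_of_isPGroup {G : Type*} [Group G] [Finite G]
    {H K : Subgroup G} {l r : ℕ} [Fact l.Prime] (hr : r.Prime) (hrl : r ≠ l)
    (hrH : r ∣ Nat.card H) (hK : IsPGroup l K) :
    IsEmpty (MulAction.fixedPoints H (G ⧸ K)) := by
  refine ⟨fun ⟨x, hx⟩ => ?_⟩
  have := Fact.mk hr
  obtain ⟨g, rfl⟩ := QuotientGroup.mk_surjective x
  obtain ⟨h, hh⟩ := exists_prime_orderOf_dvd_card' r hrH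
  have hmem : g⁻¹ * h * g ∈ K := by
    have hfix : ((h * g : G) : G ⧸ K) = g := hx h
    simpa [mul_assoc] using QuotientGroup.eq.mp hfix.symm
  obtain ⟨n, hn⟩ := IsPGroup.iff_orderOf.mp hK ⟨_, hmem⟩
  have hconj : orderOf (g⁻¹ * h * g : G) = r := by
    rw [← hh, ← Subgroup.orderOf_coe]
    simpa using orderOf_injective (MulAut.conj g⁻¹).toMonoidHom (MulAut.conj g⁻¹).injective (h : G)
  rw [← Subgroup.orderOf_coe, hconj] at hn
  exact hrl ((Nat.prime_dvd_prime_iff_eq hr Fact.out).mp (hr.dvd_of_dvd_pow hn.dvd))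

/-- If `r ≠ l` is a prime factor of `|H|`, then `φ^H(I(G))` contains the index of every
`l`-subgroup. -/
theorem index_mem_phiIdeal {G : Type*} [Group G] [Finite G] {H K : Subgroup G} {l r : ℕ}
    [Fact l.Prime] (hr : r.Prime) (hrl : r ≠ l) (hrH : r ∣ Nat.card H) (hK : IsPGroup l K) :
    (K.index : ℤ) ∈ phiIdeal G H := by
  have := isEmpty_fixedPoints_quotient_of_isPGroup hr hrl hrH hK
  rw [← neg_mem_iff]
  exact Ideal.subset_span ⟨K, by simp [Nat.card_of_isEmpty]⟩

theorem stmt1 (G : Type*) [Group G] [Finite G] (H : Subgroup G) (p q : ℕ)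
    (hp : p.Prime) (hq : q.Prime) (hpq : p ≠ q)
    (hpd : p ∣ Nat.card H) (hqd : q ∣ Nat.card H) :
    phiIdeal G H = ⊤ := by
  obtain ⟨n, hn⟩ := IsPrincipalIdealRing.principal (phiIdeal G H)
  rw [hn]
  refine Ideal.span_singleton_eq_top.mpr (Int.isUnit_iff_natAbs_eq.mpr ?_)
  by_contra hne
  obtain ⟨l, hl, hln⟩ := Nat.exists_prime_and_dvd hne
  have := Fact.mk hl
  obtain ⟨r, hr, hrl, hrH⟩ : ∃ r : ℕ, r.Prime ∧ r ≠ l ∧ r ∣ Nat.card H := by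
    by_cases h : p = l
    · exact ⟨q, hq, fun hql => hpq (h.trans hql.symm), hqd⟩
    · exact ⟨p, hp, h, hpd⟩
  let P : Sylow l G := default
  have hmem := index_mem_phiIdeal hr hrl hrH P.isPGroup'
  rw [hn] at hmem
  have hdvd : (l : ℤ) ∣ (P.index : ℤ) :=
    (Int.natCast_dvd.mpr hln).trans (Ideal.mem_span_singleton.mp hmem)
  exact P.not_dvd_index (Int.natCast_dvd_natCast.mp hdvd)
end

section
/- Let G be a finite group, let q be a prime, let Q be a Sylow q-subgroup of G, and let H be a subgroup of G that is not a q-group (i.e., the order of H is not a power of q). Then the index |G : Q| belongs to φ^H(I(G)), the ideal of ℤ generated by the integers |(G/K)^H| − |G:K| as K ranges over all subgroups of G. -/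
theorem isPGroup_of_mem_fixedPoints_quotient {G : Type*} [Group G] {p : ℕ} {H K : Subgroup G}
    (hK : IsPGroup p K) {x : G ⧸ K} (hx : x ∈ MulAction.fixedPoints H (G ⧸ K)) :
    IsPGroup p H := by
  obtain ⟨g, rfl⟩ := QuotientGroup.mk_surjective x
  intro h
  have hfix : ((h * g : G) : G ⧸ K) = (g : G ⧸ K) := hx h
  have hmem : g⁻¹ * (h * g) ∈ K := QuotientGroup.eq.mp hfix.symm
  obtain ⟨k, hk⟩ := hK ⟨_, hmem⟩
  refine ⟨k, Subtype.ext ?_⟩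
  have hpow : (g⁻¹ * h * g⁻¹⁻¹) ^ p ^ k = 1 := by
    simpa [mul_assoc] using congrArg Subtype.val hk
  rwa [conj_pow, conj_eq_one_iff] at hpow

theorem stmt6 (G : Type*) [Group G] [Finite G] (q : ℕ) (hq : q.Prime)
    (Q : Sylow q G) (H : Subgroup G) (hH : ¬ IsPGroup q H) :
    (((Q : Subgroup G).index : ℤ)) ∈ phiIdeal G H := by
  have hempty : IsEmpty (MulAction.fixedPoints H (G ⧸ (Q : Subgroup G))) :=
    ⟨fun x => hH (isPGroup_of_mem_fixedPoints_quotient Q.isPGroup' x.2)⟩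
  rw [← neg_mem_iff]
  exact Ideal.subset_span ⟨Q, by simp⟩
end

section
/- Let G be a finite group, let p be a prime, and let H be a nontrivial subgroup of G that is a p-group. Then the order of a Sylow p-subgroup of G (i.e., the largest power of p dividing |G|) belongs to φ^H(I(G)), the ideal of ℤ generated by the integers |(G/K)^H| − |G:K| as K ranges over all subgroups of G. In particular, φ^H(I(G)) contains a positive power of p. -/
/-- A nontrivial `p`-subgroup fixes no coset of a subgroup whose order is prime to `p`. -/
theorem isEmpty_fixedPoints_of_coprime {G : Type*} [Group G] {p : ℕ}
    {H K : Subgroup G} (hne : H ≠ ⊥) (hpgroup : IsPGroup p H)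
    (hK : (Nat.card K).Coprime p) : IsEmpty (MulAction.fixedPoints H (G ⧸ K)) := by
  refine ⟨fun ⟨x, hx⟩ => hne ?_⟩
  obtain ⟨g, rfl⟩ := QuotientGroup.mk_surjective x
  refine (Subgroup.eq_bot_iff_forall H).2 fun h hh => ?_
  have hmem : g⁻¹ * h * g ∈ K := by
    have h1 : ((h * g : G) : G ⧸ K) = (g : G ⧸ K) := hx ⟨h, hh⟩
    simpa [mul_assoc] using QuotientGroup.eq.1 h1.symm
  obtain ⟨n, hn⟩ := hpgroup ⟨h, hh⟩
  have hn' : h ^ p ^ n = 1 := congrArg Subtype.val hn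
  have hconj : (g⁻¹ * h * g) ^ p ^ n = 1 := by
    have := conj_pow (i := p ^ n) (a := g⁻¹) (b := h)
    rw [inv_inv] at this
    rw [this, hn']
    simp
  have hcard : (g⁻¹ * h * g) ^ Nat.card K = 1 :=
    congrArg Subtype.val (pow_card_eq_one' (x := (⟨_, hmem⟩ : K)))
  have hone : g⁻¹ * h * g = 1 := by
    rw [← orderOf_eq_one_iff]
    exact Nat.eq_one_of_dvd_coprimes (hK.pow_right n)
      (orderOf_dvd_of_pow_eq_one hcard) (orderOf_dvd_of_pow_eq_one hconj)
  rw [mul_assoc, inv_mul_eq_one] at hone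
  exact mul_eq_right.1 hone.symm

theorem index_mem_phiIdeal_s7 {G : Type*} [Group G] {p : ℕ}
    {H K : Subgroup G} (hne : H ≠ ⊥) (hpgroup : IsPGroup p H)
    (hK : (Nat.card K).Coprime p) : (K.index : ℤ) ∈ phiIdeal G H := by
  have := isEmpty_fixedPoints_of_coprime hne hpgroup hK
  rw [← neg_mem_iff]
  exact Ideal.subset_span ⟨K, by simp⟩

theorem stmt7 (G : Type*) [Group G] [Finite G] (p : ℕ) (hp : p.Prime)
    (H : Subgroup G) (hne : H ≠ ⊥) (hpgroup : IsPGroup p H) :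
    ((p ^ (Nat.card G).factorization p : ℕ) : ℤ) ∈ phiIdeal G H ∧
      ∃ k : ℕ, 0 < k ∧ ((p : ℤ) ^ k) ∈ phiIdeal G H := by
  have hG : Nat.card G ≠ 0 := Nat.card_pos.ne'
  have hmem : ((p ^ (Nat.card G).factorization p : ℕ) : ℤ) ∈ phiIdeal G H := by
    obtain ⟨d, hd⟩ := (IsPrincipalIdealRing.principal (phiIdeal G H)).principal
    have hdvd {K : Subgroup G} (hK : (Nat.card K).Coprime p) : d.natAbs ∣ K.index := by
      have h := index_mem_phiIdeal_s7 hne hpgroup hK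
      rw [hd] at h
      exact Int.natAbs_dvd_natAbs.2 (Ideal.mem_span_singleton.1 h)
    have hdG : d.natAbs ∣ Nat.card G := by
      simpa using hdvd (K := ⊥) (by simp)
    have hd0 : d.natAbs ≠ 0 := ne_zero_of_dvd_ne_zero hG hdG
    rw [hd]
    refine Ideal.mem_span_singleton.2 (Int.natAbs_dvd_natAbs.1 ?_)
    rw [Int.natAbs_natCast]
    refine (Nat.factorization_le_iff_dvd hd0 (pow_ne_zero _ hp.ne_zero)).1 fun q => ?_
    by_cases hqp : q = p
    · subst hqp
      simpa [hp.factorization] using (Nat.factorization_le_iff_dvd hd0 hG).2 hdG q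
    by_cases hq : q.Prime
    · have : Fact q.Prime := ⟨hq⟩
      let Q : Sylow q G := default
      have hQ : (Nat.card Q).Coprime p := by
        rw [Q.card_eq_multiplicity]
        exact ((Nat.coprime_primes hq hp).2 hqp).pow_left _
      have hnd : ¬ q ∣ d.natAbs := fun h => Q.not_dvd_index (h.trans (hdvd hQ))
      rw [Nat.factorization_eq_zero_of_not_dvd hnd]
      exact Nat.zero_le _
    · rw [Nat.factorization_eq_zero_of_not_prime _ hq]
      exact Nat.zero_le _
  refine ⟨hmem, (Nat.card G).factorization p, ?_, by exact_mod_cast hmem⟩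
  have : Fact p.Prime := ⟨hp⟩
  have : Nontrivial H := (Subgroup.nontrivial_iff_ne_bot H).2 hne
  obtain ⟨n, hn, hcard⟩ := hpgroup.nontrivial_iff_card.1 this
  refine hp.factorization_pos_of_dvd hG ((dvd_pow_self p hn.ne').trans ?_)
  exact hcard ▸ H.card_subgroup_dvd_card
end
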